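/- Let t, q be valid centreness parameters (0 < 2q ≤ t ≤ 1, q < 1/2), let α > 0, let ñ > 0 and let λ be a real with 0 ≤ λ < ñ. Let c : [0, ñ] → ℝ be the centreness function with parameters t, q and noisy count ñ, and let e(ξ) = 1 − ξ/ñ be the emptiness. Define the score of a pair (r, ξ) as f(r, ξ) = c(r) + α·e(ξ). Then for all ranks r, r' ∈ [0, ñ] with |r − r'| ≤ 1 and all nonnegative reals ξ, ξ' with |ξ − ξ'| ≤ 1, one has |f(r, ξ) − f(r', ξ')| ≤ (t/q + α)/(ñ − λ). (This bounds the sensitivity of DPM's scoring function by (t/q + α)/(ñ − λ).) -/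

import Mathlib

/-- The centreness function with parameters `t`, `q` and noisy count `n`. -/
noncomputable def centreness (t q n : ℝ) (r : ℝ) : ℝ :=
  if r ≤ n * q ∨ n - n * q ≤ r then
    t * (n / 2 - |r - n / 2|) / (n * q)
  else
    (t - 2 * q) / (1 - 2 * q) + (1 - t) * (n / 2 - |r - n / 2|) / (n / 2 - n * q)

/-- The slope of the centreness function on the inner quantile is at most its slope on the
outer quantiles. -/
theorem centreness_inner_slope_le {t q n : ℝ} (hq : 0 < q) (htq : 2 * q ≤ t)
    (hq2 : q < 1 / 2) (hn : 0 < n) :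
    (1 - t) / (n / 2 - n * q) ≤ t / (n * q) := by
  have h : 0 < n / 2 - n * q := by nlinarith
  rw [div_le_div_iff₀ h (by positivity)]
  nlinarith

/-- The centreness function is the minimum of two affine functions of the distance to the
nearest end of `[0, n]`. -/
theorem centreness_eq_min {t q n : ℝ} (hq : 0 < q) (htq : 2 * q ≤ t)
    (hq2 : q < 1 / 2) (hn : 0 < n) (r : ℝ) :
    centreness t q n r =
      min (t + t / (n * q) * (n / 2 - |r - n / 2| - n * q))
        (t + (1 - t) / (n / 2 - n * q) * (n / 2 - |r - n / 2| - n * q)) := by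
  have hslope := centreness_inner_slope_le hq htq hq2 hn
  unfold centreness
  split_ifs with h
  · have hm : n / 2 - |r - n / 2| - n * q ≤ 0 := by
      rcases h with h | h
      · linarith [neg_abs_le (r - n / 2)]
      · linarith [le_abs_self (r - n / 2)]
    rw [min_eq_left (by linarith [mul_le_mul_of_nonpos_right hslope hm])]
    field_simp
    ring
  · push Not at h
    have hm : 0 ≤ n / 2 - |r - n / 2| - n * q := by
      have : |r - n / 2| ≤ n / 2 - n * q := abs_le.mpr ⟨by linarith, by linarith⟩
      linarith
    rw [min_eq_right (by linarith [mul_le_mul_of_nonneg_right hslope hm])]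
    have h1 : 1 - 2 * q ≠ 0 := by linarith
    have h2 : n / 2 - n * q = n * (1 - 2 * q) / 2 := by ring
    rw [h2]
    field_simp
    ring

/-- The centreness function is Lipschitz with constant its slope on the outer quantiles. -/
theorem abs_centreness_sub_le {t q n : ℝ} (hq : 0 < q) (htq : 2 * q ≤ t) (ht : t ≤ 1)
    (hq2 : q < 1 / 2) (hn : 0 < n) (r r' : ℝ) :
    |centreness t q n r - centreness t q n r'| ≤ t / (n * q) * |r - r'| := by
  have hslope := centreness_inner_slope_le hq htq hq2 hn
  have hk : 0 ≤ (1 - t) / (n / 2 - n * q) := div_nonneg (by linarith) (by nlinarith)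
  have hdist : |(|r' - n / 2| - |r - n / 2|)| ≤ |r - r'| := by
    have := abs_abs_sub_abs_le (r' - n / 2) (r - n / 2)
    rwa [sub_sub_sub_cancel_right, abs_sub_comm r' r] at this
  have hlin : ∀ k : ℝ, 0 ≤ k → k ≤ t / (n * q) →
      |(t + k * (n / 2 - |r - n / 2| - n * q)) - (t + k * (n / 2 - |r' - n / 2| - n * q))|
        ≤ t / (n * q) * |r - r'| := by
    intro k hk0 hk1
    rw [show (t + k * (n / 2 - |r - n / 2| - n * q)) - (t + k * (n / 2 - |r' - n / 2| - n * q))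
      = k * (|r' - n / 2| - |r - n / 2|) by ring, abs_mul, abs_of_nonneg hk0]
    exact mul_le_mul hk1 hdist (abs_nonneg _) (hk0.trans hk1)
  rw [centreness_eq_min hq htq hq2 hn, centreness_eq_min hq htq hq2 hn]
  exact (abs_min_sub_min_le_max _ _ _ _).trans
    (max_le (hlin _ (hk.trans hslope) le_rfl) (hlin _ hk hslope))

/-- Sensitivity of DPM's scoring function `f(r, ξ) = c(r) + α·(1 − ξ/n)`:
if the ranks differ by at most one and the counts differ by at most one,
then the scores differ by at most `(t/q + α)/(n − λ)`. -/
theorem score_sensitivity (t q n lam a : ℝ) (hq : 0 < q) (htq : 2 * q ≤ t) (ht : t ≤ 1)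
    (hq2 : q < 1 / 2) (ha : 0 < a) (hn : 0 < n) (hlam : 0 ≤ lam) (hlamn : lam < n) :
    ∀ r ∈ Set.Icc (0 : ℝ) n, ∀ r' ∈ Set.Icc (0 : ℝ) n, |r - r'| ≤ 1 →
      ∀ ξ ξ' : ℝ, 0 ≤ ξ → 0 ≤ ξ' → |ξ - ξ'| ≤ 1 →
        |(centreness t q n r + a * (1 - ξ / n)) -
            (centreness t q n r' + a * (1 - ξ' / n))| ≤ (t / q + a) / (n - lam) := by
  intro r _ r' _ hr ξ ξ' _ _ hξ
  have ht0 : 0 < t := by linarith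
  have hc : |centreness t q n r - centreness t q n r'| ≤ t / (n * q) :=
    (abs_centreness_sub_le hq htq ht hq2 hn r r').trans
      (mul_le_of_le_one_right (by positivity) hr)
  have he : |a / n * (ξ' - ξ)| ≤ a / n := by
    rw [abs_mul, abs_of_pos (by positivity : 0 < a / n), abs_sub_comm]
    exact mul_le_of_le_one_right (by positivity) hξ
  calc |(centreness t q n r + a * (1 - ξ / n)) - (centreness t q n r' + a * (1 - ξ' / n))|
      = |(centreness t q n r - centreness t q n r') + a / n * (ξ' - ξ)| := by
        congr 1
        ring
    _ ≤ t / (n * q) + a / n := (abs_add_le _ _).trans (add_le_add hc he)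
    _ = (t / q + a) / n := by field_simp
    _ ≤ (t / q + a) / (n - lam) :=
        div_le_div_of_nonneg_left (by positivity) (by linarith) (by linarith)
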